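/- The Euclidean angles satisfy ∠L' X L₀ = ∠L₀ X L'' = ∠L₀ L L'' = arctan(1/2). -/

import Mathlib

open EuclideanGeometry

/-- The angle between two plane vectors with positive inner product is the arctangent of the
quotient of the absolute value of their determinant by their inner product. -/
theorem angle_eq_arctan_of_abs_det_eq {u v : EuclideanSpace ℝ (Fin 2)} {k : ℝ} (hk : 0 ≤ k)
    (hpos : 0 < u 0 * v 0 + u 1 * v 1)
    (hdet : |u 0 * v 1 - u 1 * v 0| = k * (u 0 * v 0 + u 1 * v 1)) :
    InnerProductGeometry.angle u v = Real.arctan k := by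
  have hinner : inner ℝ u v = u 0 * v 0 + u 1 * v 1 := by
    simp [PiLp.inner_apply, Fin.sum_univ_two, mul_comm]
  have hnorm : ‖u‖ * ‖v‖ = (u 0 * v 0 + u 1 * v 1) * √(1 + k ^ 2) := by
    rw [← sq_eq_sq₀ (by positivity) (by positivity), mul_pow, mul_pow, Real.sq_sqrt (by positivity),
      EuclideanSpace.real_norm_sq_eq, EuclideanSpace.real_norm_sq_eq]
    have hsq := congrArg (· ^ 2) hdet
    simp only [sq_abs, Fin.sum_univ_two] at hsq ⊢
    linear_combination hsq
  rw [InnerProductGeometry.angle, hinner, hnorm, Real.arctan_eq_arccos hk,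
    div_mul_cancel_left₀ hpos.ne']

/-- The Euclidean angles satisfy
∠L' X L₀ = ∠L₀ X L'' = ∠L₀ L L'' = arctan(1/2). -/
theorem stmt_6 (t : ℝ) (ht : 0 < t)
    (O L T X Y L₀ L₁ L₂ L' L'' : EuclideanSpace ℝ (Fin 2))
    (hO : O = !₂[0, 0]) (hL : L = !₂[-t, 0]) (hT : T = !₂[0, t])
    (hX : X = !₂[-t/2, t/2]) (hY : Y = !₂[-t/3, t/3])
    (hL0 : L₀ = !₂[-t/2, 0]) (hL1 : L₁ = !₂[-3*t/4, 0]) (hL2 : L₂ = !₂[-t/4, 0])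
    (hL' : L' = !₂[-2*t/3, t/6]) (hL'' : L'' = !₂[-2*t/5, 3*t/10]) :
    ∠ L' X L₀ = ∠ L₀ X L'' ∧
    ∠ L₀ X L'' = ∠ L₀ L L'' ∧
    ∠ L₀ L L'' = Real.arctan (1/2) := by
  have ht2 : 0 < t ^ 2 := by positivity
  have h₁ : ∠ L' X L₀ = Real.arctan (1/2) := by
    subst hX hL0 hL'
    apply angle_eq_arctan_of_abs_det_eq (by norm_num)
    · simp
      nlinarith
    · rw [abs_of_nonneg (by simp; nlinarith)]
      simp
      ring
  have h₂ : ∠ L₀ X L'' = Real.arctan (1/2) := by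
    subst hX hL0 hL''
    apply angle_eq_arctan_of_abs_det_eq (by norm_num)
    · simp
      nlinarith
    · rw [abs_of_nonneg (by simp; nlinarith)]
      simp
      ring
  have h₃ : ∠ L₀ L L'' = Real.arctan (1/2) := by
    subst hL hL0 hL''
    apply angle_eq_arctan_of_abs_det_eq (by norm_num)
    · simp
      nlinarith
    · rw [abs_of_nonneg (by simp; nlinarith)]
      simp
      ring
  exact ⟨h₁.trans h₂.symm, h₂.trans h₃.symm, h₃⟩
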